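/- arXiv:2310.06379 — 8 statements merged into one kernel-verified Lean document; each statement's English description precedes it below -/
import Mathlib

section
/- Let N ≥ 2 be an even integer and K an integer with 1 ≤ K ≤ N/2 + 1. Then the K matrices M^{(0)}, …, M^{(K−1)} ∈ ℝ^{N×N} defined by M^{(k)}_{β,β'} := cos(θ^{(k)}_{β,β'}) are linearly independent in the real vector space of N × N real matrices. -/
open Real Finset

/-- `θ^{(k)}_{α,α'} = (2πk/N)(α - α')`. -/
noncomputable def θConst (N : ℕ) (k : ℕ) (α α' : Fin N) : ℝ :=
  2 * π * (k : ℝ) / (N : ℝ) * ((α : ℝ) - (α' : ℝ))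

/-- The cosine matrices `M^{(k)}_{β,β'} = cos(θ^{(k)}_{β,β'})`, `k = 0, …, K-1`. -/
noncomputable def cosMat (N K : ℕ) (k : Fin K) : Matrix (Fin N) (Fin N) ℝ :=
  Matrix.of fun β β' => Real.cos (θConst N (k : ℕ) β β')

/-- The `K` cosine matrices are linearly independent in `ℝ^{N×N}`. -/
theorem stmt4 (N K : ℕ) (hN : 2 ≤ N) (hNeven : Even N) (hK1 : 1 ≤ K)
    (hK : K ≤ N / 2 + 1) :
    LinearIndependent ℝ (cosMat N K) := by
  have hNpos : (0 : ℝ) < N := by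
    have : 0 < N := by omega
    exact_mod_cast this
  -- cosine sequences on the integers are eigenvectors of the symmetric shift
  let v : Fin K → (ℤ → ℝ) := fun k j => Real.cos (2 * π * ((k : ℕ) : ℝ) / N * j)
  let T : Module.End ℝ (ℤ → ℝ) :=
    { toFun := fun f j => f (j + 1) + f (j - 1)
      map_add' := by intro f g; ext j; simp only [Pi.add_apply]; ring
      map_smul' := by
        intro c f; ext j
        simp only [Pi.smul_apply, smul_eq_mul, RingHom.id_apply]; ring }
  have hle : ∀ k : Fin K, 2 * π * ((k : ℕ) : ℝ) / N ∈ Set.Icc 0 π := by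
    intro k
    have h2 : 2 * (k : ℕ) ≤ N := by have := k.2; omega
    have h3 : 2 * ((k : ℕ) : ℝ) ≤ N := by exact_mod_cast h2
    refine ⟨by positivity, ?_⟩
    rw [div_le_iff₀ hNpos]
    nlinarith [Real.pi_pos]
  have hv : LinearIndependent ℝ v := by
    refine Module.End.eigenvectors_linearIndependent' T
      (fun k : Fin K => 2 * Real.cos (2 * π * ((k : ℕ) : ℝ) / N)) ?_ v ?_
    · intro a b hab
      have h1 := Real.injOn_cos (hle a) (hle b) (mul_left_cancel₀ two_ne_zero hab)
      rw [div_left_inj' hNpos.ne'] at h1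
      have h2 := mul_left_cancel₀ (by positivity : (2 * π) ≠ 0) h1
      exact Fin.ext (by exact_mod_cast h2)
    · intro k
      refine ⟨Module.End.mem_eigenspace_iff.mpr ?_, ?_⟩
      · ext j
        change Real.cos _ + Real.cos _ = _ * Real.cos _
        push_cast
        rw [mul_add, mul_sub, Real.cos_add, Real.cos_sub, mul_one]
        ring
      · intro h
        have := congrFun h 0
        simp [v] at this
  rw [Fintype.linearIndependent_iff] at hv ⊢
  intro c hc
  apply hv
  ext j
  have hN0 : (N : ℤ) ≠ 0 := by omega
  have hr0 := Int.emod_nonneg j hN0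
  have hr1 := Int.emod_lt_of_pos j (by omega : (0 : ℤ) < N)
  obtain ⟨r, hr⟩ := Int.eq_ofNat_of_zero_le hr0
  have hj := Int.mul_ediv_add_emod j N
  rw [hr] at hj hr1
  have hrN : r < N := by exact_mod_cast hr1
  have h := congrFun (congrFun hc ⟨r, hrN⟩) ⟨0, by omega⟩
  simp only [Matrix.sum_apply, Matrix.smul_apply, cosMat, Matrix.of_apply, θConst,
    Matrix.zero_apply, smul_eq_mul, Nat.cast_zero, sub_zero] at h
  simp only [Finset.sum_apply, Pi.smul_apply, smul_eq_mul, Pi.zero_apply, v]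
  rw [← h]
  refine Finset.sum_congr rfl fun k _ => ?_
  congr 1
  have hjr : (j : ℝ) = N * ((j / N : ℤ) : ℝ) + r := by exact_mod_cast hj.symm
  rw [hjr, ← Real.cos_add_int_mul_two_pi (2 * π * ((k : ℕ) : ℝ) / N * r) ((k : ℕ) * (j / N))]
  congr 1
  push_cast
  field_simp
  ring
end

section
/- (A DCN fixed point with c* = 1 is a fixed point of the simplified FNO covariance map.) Let γ denote the standard Gaussian measure N(0,1) on ℝ. Let φ : ℝ → ℝ be measurable, q* > 0, and σ, σ_b ∈ ℝ, with ∫ φ(√q* z)² dγ(z) finite, and suppose σ² ∫ φ(√q* z)² dγ(z) + σ_b² = q*. Then for every even integer N ≥ 2, every integer K with 1 ≤ K ≤ N/2 + 1, and all α, α' ∈ {0,…,N−1}: (1/N²) ∑_{k=0}^{K−1} c_k cos(θ^{(k)}_{α,α'}) ∑_{β=0}^{N−1} ∑_{β'=0}^{N−1} cos(θ^{(k)}_{β,β'}) · ( σ² ∫ φ(√q* z)² dγ(z) + σ_b² ) = q*. (The expression σ² ∫ φ(√q* z)² dγ(z) + σ_b² equals σ² E[φ(H_β)φ(H_{β'})]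 + σ_b² for any β, β' when H is a centered Gaussian vector with the degenerate covariance q* 𝟙𝟙ᵀ, since then all coordinates H_β coincide with √q* z for a single standard Gaussian z; thus this states that Σ* = q* 𝟙𝟙ᵀ is a fixed point of the simplified FNO iterated covariance map.) -/
open Real Finset MeasureTheory ProbabilityTheory

/-- `c_k = 2 - [k = 0] - [k = N/2]`. -/
noncomputable def cConst (N k : ℕ) : ℝ := if k = 0 ∨ k = N / 2 then 1 else 2

lemma sum_cos_zero (N k : ℕ) (hk : 0 < k) (hkN : k < N) (β : Fin N) :
    ∑ β' : Fin N, Real.cos (θConst N k β β') = 0 := by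
  have hN : N ≠ 0 := by omega
  have hNc : (N : ℂ) ≠ 0 := by exact_mod_cast hN
  have hp := Complex.isPrimitiveRoot_exp N hN
  set ζ := Complex.exp (2 * π * Complex.I / N) with hζ
  have hx1 : ζ ^ k ≠ 1 := hp.pow_ne_one_of_pos_of_lt hk.ne' hkN
  have hxN : (ζ ^ k) ^ N = 1 := by rw [← pow_mul, mul_comm, pow_mul, hp.pow_eq_one, one_pow]
  have hsum : ∑ i ∈ Finset.range N, (ζ ^ k) ^ i = 0 := by
    have h := geom_sum_mul (ζ ^ k) N
    rw [hxN, sub_self] at h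
    exact (mul_eq_zero.mp h).resolve_right (sub_ne_zero.mpr hx1)
  have key : ∀ β' : Fin N, Real.cos (θConst N k β β') =
      (Complex.exp (-(2 * π * k / N * (β : ℕ) : ℝ) * Complex.I) * (ζ ^ k) ^ (β' : ℕ)).re := by
    intro β'
    rw [← pow_mul, hζ, ← Complex.exp_nat_mul, ← Complex.exp_add, ← Real.cos_neg,
      ← Complex.exp_ofReal_mul_I_re]
    congr 2
    unfold θConst
    push_cast
    ring
  simp_rw [key]
  rw [← Complex.re_sum, ← Finset.mul_sum, Fin.sum_univ_eq_sum_range (fun i => (ζ ^ k) ^ i), hsum]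
  simp

/-- A DCN fixed point with `c* = 1` is a fixed point of the simplified FNO
covariance map. -/
theorem stmt6 (φ : ℝ → ℝ) (hφ : Measurable φ) (qs : ℝ) (hq : 0 < qs) (σ σb : ℝ)
    (hInt : Integrable (fun z => φ (Real.sqrt qs * z) ^ 2) (gaussianReal 0 1))
    (hfix : σ ^ 2 * (∫ z, φ (Real.sqrt qs * z) ^ 2 ∂(gaussianReal 0 1)) + σb ^ 2 = qs)
    (N K : ℕ) (hN : 2 ≤ N) (hNeven : Even N) (hK1 : 1 ≤ K) (hK : K ≤ N / 2 + 1)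
    (α α' : Fin N) :
    (1 / (N : ℝ) ^ 2) * ∑ k ∈ Finset.range K, cConst N k * Real.cos (θConst N k α α') *
        ∑ β : Fin N, ∑ β' : Fin N, Real.cos (θConst N k β β') *
          (σ ^ 2 * (∫ z, φ (Real.sqrt qs * z) ^ 2 ∂(gaussianReal 0 1)) + σb ^ 2)
      = qs := by
  rw [hfix]
  have hN0 : (N : ℝ) ≠ 0 := by
    have : N ≠ 0 := by omega
    exact_mod_cast this
  rw [Finset.sum_eq_single_of_mem 0 (Finset.mem_range.mpr hK1)]
  · simp [cConst, θConst]
    field_simp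
  · intro k hk hk0
    have hkK := Finset.mem_range.mp hk
    have : ∀ β : Fin N, ∑ β' : Fin N, Real.cos (θConst N k β β') * qs = 0 := by
      intro β
      rw [← Finset.sum_mul, sum_cos_zero N k (by omega) (by omega) β, zero_mul]
    simp [this]
end

section
/- (Lemma A.4: periodic eigenmatrices of the linearized covariance map.) Let N ≥ 2 be even, K an integer with 2 ≤ K ≤ N/2 + 1, and χ_{q*}, χ_κ, χ_{c*} real parameters. Define J : ℝ^{N×N} → ℝ^{N×N} by [J(E)]_{α,α'} := (1/N²) ∑_{k'=0}^{K−1} c_{k'} cos(θ^{(k')}_{α,α'}) ∑_{β=0}^{N−1} ∑_{β'=0}^{N−1} cos(θ^{(k')}_{β,β'}) ( [β = β'] (χ_{q*} − χ_κ + [k' = 0] N χ_κ) + [β ≠ β'] χ_{c*} ) E_{β,β'}. For k ∈ {1, …, K−1} define ψ^{(k)} ∈ ℝ^{N×N} by ψ^{(k)}_{β,β'} := cos(θ^{(k)}_{β,β'}) − (∑_{s=0}^{K−1} c_s)^{−1} ∑_{s=0}^{K−1} c_s cos(θ^{(s)}_{β,β'}). Then for every k ∈ {1, …, K−1}, J(ψ^{(k)})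 = χ_{c*} ψ^{(k)}. -/
open Real Finset

/-- The linearized covariance map `J` of the simplified FNO at the fixed point:
`[J(E)]_{α,α'} = (1/N²) ∑_{k'<K} c_{k'} cos(θ^{(k')}_{α,α'}) ∑_{β,β'} cos(θ^{(k')}_{β,β'})
  ([β=β'](χ_{q*} - χ_κ + [k'=0] N χ_κ) + [β≠β'] χ_{c*}) E_{β,β'}`. -/
noncomputable def Jmap (N K : ℕ) (χq χκ χc : ℝ)
    (E : Matrix (Fin N) (Fin N) ℝ) : Matrix (Fin N) (Fin N) ℝ :=
  Matrix.of fun α α' =>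
    (1 / (N : ℝ) ^ 2) * ∑ k' ∈ Finset.range K, cConst N k' * Real.cos (θConst N k' α α') *
      ∑ β : Fin N, ∑ β' : Fin N, Real.cos (θConst N k' β β') *
        ((if β = β' then χq - χκ + (if k' = 0 then (N : ℝ) * χκ else 0) else χc) * E β β')

/-- The periodic eigenmatrix `ψ^{(k)}` of the linearized covariance map. -/
noncomputable def ψper (N K k : ℕ) : Matrix (Fin N) (Fin N) ℝ :=
  Matrix.of fun β β' => Real.cos (θConst N k β β') -
    (∑ s ∈ Finset.range K, cConst N s)⁻¹ *
      ∑ s ∈ Finset.range K, cConst N s * Real.cos (θConst N s β β')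


lemma geom_zero (N : ℕ) (hN : 0 < N) (m : ℤ) (hm : ¬ (N : ℤ) ∣ m) :
    ∑ β : Fin N, Complex.exp (((2 * π * (m : ℝ) / (N : ℝ) * (β : ℝ) : ℝ) : ℂ) * Complex.I) = 0 := by
  have hN0 : (N : ℂ) ≠ 0 := by exact_mod_cast hN.ne'
  set z : ℂ := Complex.exp (2 * π * (m : ℂ) / (N : ℂ) * Complex.I) with hz
  have h1 : z ≠ 1 := by
    intro h
    rw [hz, Complex.exp_eq_one_iff] at h
    obtain ⟨n, hn⟩ := h
    apply hm
    refine ⟨n, ?_⟩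
    have hpi : (2 * π * Complex.I : ℂ) ≠ 0 := Complex.two_pi_I_ne_zero
    have : (m : ℂ) = N * n := by
      apply mul_left_cancel₀ hpi
      field_simp at hn
      linear_combination (2 * π * Complex.I : ℂ) * hn
    exact_mod_cast this
  have h2 : z ^ N = 1 := by
    rw [hz, ← Complex.exp_nat_mul, Complex.exp_eq_one_iff]
    refine ⟨m, ?_⟩
    field_simp
  have h3 : ∀ β : Fin N,
      Complex.exp (((2 * π * (m : ℝ) / (N : ℝ) * (β : ℝ) : ℝ) : ℂ) * Complex.I) = z ^ (β : ℕ) := by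
    intro β
    rw [hz, ← Complex.exp_nat_mul]
    congr 1
    push_cast
    ring
  rw [Finset.sum_congr rfl (fun β _ => h3 β), Fin.sum_univ_eq_sum_range (fun i => z ^ i) N,
    geom_sum_eq h1, h2]
  simp

lemma cos_sum (N : ℕ) (hN : 0 < N) (m : ℤ) :
    ∑ β : Fin N, ∑ β' : Fin N,
      Real.cos (2 * π * (m : ℝ) / (N : ℝ) * ((β : ℝ) - (β' : ℝ))) =
      if (N : ℤ) ∣ m then (N : ℝ) ^ 2 else 0 := by
  have hN0 : (N : ℝ) ≠ 0 := by exact_mod_cast hN.ne'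
  split_ifs with h
  · obtain ⟨n, rfl⟩ := h
    have : ∀ β β' : Fin N,
        Real.cos (2 * π * (((N : ℤ) * n : ℤ) : ℝ) / (N : ℝ) * ((β : ℝ) - (β' : ℝ))) = 1 := by
      intro β β'
      rw [Real.cos_eq_one_iff]
      refine ⟨n * ((β : ℕ) - (β' : ℕ) : ℤ), ?_⟩
      push_cast
      field_simp
    simp only [this]
    simp [sq]
  · have hg := geom_zero N hN m h
    have hC : ∑ β : Fin N, Real.cos (2 * π * (m : ℝ) / (N : ℝ) * (β : ℝ)) = 0 := by
      have := congrArg Complex.re hg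
      simpa only [Complex.re_sum, Complex.exp_ofReal_mul_I_re, Complex.zero_re] using this
    have hS : ∑ β : Fin N, Real.sin (2 * π * (m : ℝ) / (N : ℝ) * (β : ℝ)) = 0 := by
      have := congrArg Complex.im hg
      simpa only [Complex.im_sum, Complex.exp_ofReal_mul_I_im, Complex.zero_im] using this
    simp only [mul_sub, Real.cos_sub, Finset.sum_add_distrib, ← Finset.mul_sum, hC, hS]
    simp

lemma orth (N : ℕ) (hN : 2 ≤ N) (hNe : Even N) (k s : ℕ) (hk : k ≤ N / 2) (hs : s ≤ N / 2) :
    cConst N k * ∑ β : Fin N, ∑ β' : Fin N,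
      Real.cos (θConst N k β β') * Real.cos (θConst N s β β') =
      if k = s then (N : ℝ) ^ 2 else 0 := by
  have hprod : ∀ β β' : Fin N, Real.cos (θConst N k β β') * Real.cos (θConst N s β β') =
      (1 / 2) * Real.cos (2 * π * (((k : ℤ) - s : ℤ) : ℝ) / (N : ℝ) * ((β : ℝ) - (β' : ℝ))) +
      (1 / 2) * Real.cos (2 * π * (((k : ℤ) + s : ℤ) : ℝ) / (N : ℝ) * ((β : ℝ) - (β' : ℝ))) := by
    intro β β'
    have e1 : 2 * π * (((k : ℤ) - s : ℤ) : ℝ) / (N : ℝ) * ((β : ℝ) - (β' : ℝ)) =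
      θConst N k β β' - θConst N s β β' := by
      unfold θConst; push_cast; ring
    have e2 : 2 * π * (((k : ℤ) + s : ℤ) : ℝ) / (N : ℝ) * ((β : ℝ) - (β' : ℝ)) =
      θConst N k β β' + θConst N s β β' := by
      unfold θConst; push_cast; ring
    rw [e1, e2, Real.cos_sub, Real.cos_add]
    ring
  simp only [hprod, Finset.sum_add_distrib, ← Finset.mul_sum]
  rw [cos_sum N (by omega), cos_sum N (by omega)]
  obtain ⟨M, hM⟩ := hNe
  have hM2 : N / 2 = M := by omega
  rw [hM2] at hk hs
  have d1 : ((N : ℤ) ∣ (k : ℤ) - s) ↔ k = s := by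
    constructor
    · intro h
      have := Int.eq_zero_of_abs_lt_dvd h (by rw [abs_lt]; constructor <;> omega)
      omega
    · rintro rfl; simp
  have d2 : ((N : ℤ) ∣ (k : ℤ) + s) ↔ (k = s ∧ (k = 0 ∨ k = M)) := by
    constructor
    · rintro ⟨n, hn⟩
      have hn0 : n < 2 := by
        by_contra hc
        push Not at hc
        have : (N : ℤ) * 2 ≤ N * n := mul_le_mul_of_nonneg_left hc (by omega)
        omega
      have hn1 : -1 < n := by
        by_contra hc
        push Not at hc
        have : (N : ℤ) * n ≤ N * (-1) := mul_le_mul_of_nonneg_left hc (by omega)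
        omega
      interval_cases n <;> omega
    · rintro ⟨rfl, rfl | rfl⟩
      · simp
      · rw [hM]; push_cast; exact dvd_rfl
  unfold cConst
  rw [hM2]
  simp only [d1, d2]
  by_cases h1 : k = s
  · by_cases h2 : k = 0 ∨ k = M
    · simp only [h1] at h2 ⊢
      simp only [h2, and_self, if_true]; ring
    · simp only [h1] at h2 ⊢
      simp only [h2, and_false, if_true, if_false]; ring
  · simp [h1]

theorem stmt8 (N K : ℕ) (hN : 2 ≤ N) (hNeven : Even N) (hK1 : 2 ≤ K)
    (hK : K ≤ N / 2 + 1) (χq χκ χc : ℝ) :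
    ∀ k : ℕ, 1 ≤ k → k < K →
      Jmap N K χq χκ χc (ψper N K k) = χc • ψper N K k := by
  intro k hk1 hk
  have hN0 : (N : ℝ) ≠ 0 := by
    have : N ≠ 0 := by omega
    exact_mod_cast this
  have hpos : ∀ s, 0 < cConst N s := by
    intro s; unfold cConst; split_ifs <;> norm_num
  set T : ℝ := ∑ s ∈ Finset.range K, cConst N s with hT
  have hT0 : T ≠ 0 := by
    apply ne_of_gt
    exact Finset.sum_pos (fun s _ => hpos s) ⟨0, by simp; omega⟩
  have hdiag : ∀ β : Fin N, ψper N K k β β = 0 := by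
    intro β
    simp [ψper, θConst, ← hT, hT0]
  -- coefficient of ψ against the mode j
  have hcoef : ∀ j ∈ Finset.range K, cConst N j * ∑ β : Fin N, ∑ β' : Fin N,
      Real.cos (θConst N j β β') * ψper N K k β β' =
      (N : ℝ) ^ 2 * ((if j = k then 1 else 0) - T⁻¹ * cConst N j) := by
    intro j hj
    have hj' := Finset.mem_range.1 hj
    have e : ∑ β : Fin N, ∑ β' : Fin N, Real.cos (θConst N j β β') * ψper N K k β β' =
        (∑ β : Fin N, ∑ β' : Fin N, Real.cos (θConst N j β β') * Real.cos (θConst N k β β')) -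
        T⁻¹ * ∑ s ∈ Finset.range K, cConst N s *
          ∑ β : Fin N, ∑ β' : Fin N, Real.cos (θConst N j β β') * Real.cos (θConst N s β β') := by
      simp only [Finset.mul_sum]
      rw [Finset.sum_comm (s := Finset.range K), ← Finset.sum_sub_distrib]
      refine Finset.sum_congr rfl fun β _ => ?_
      rw [Finset.sum_comm (s := Finset.range K), ← Finset.sum_sub_distrib]
      refine Finset.sum_congr rfl fun β' _ => ?_
      simp only [ψper, Matrix.of_apply, ← hT, mul_sub, Finset.mul_sum]
      congr 1
      refine Finset.sum_congr rfl fun s _ => ?_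
      ring
    rw [e, mul_sub, orth N hN hNeven j k (by omega) (by omega)]
    have e2 : cConst N j * (T⁻¹ * ∑ s ∈ Finset.range K, cConst N s *
          ∑ β : Fin N, ∑ β' : Fin N, Real.cos (θConst N j β β') * Real.cos (θConst N s β β')) =
        T⁻¹ * ∑ s ∈ Finset.range K, cConst N s * (if j = s then (N : ℝ) ^ 2 else 0) := by
      rw [mul_left_comm, Finset.mul_sum]
      congr 1
      refine Finset.sum_congr rfl fun s hs => ?_
      have hs' := Finset.mem_range.1 hs
      rw [← orth N hN hNeven j s (by omega) (by omega)]
      ring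
    rw [e2]
    simp only [mul_ite, mul_zero, Finset.sum_ite_eq, hj, if_true]
    split_ifs <;> ring
  ext α α'
  have hin : ∀ j ∈ Finset.range K, cConst N j * Real.cos (θConst N j α α') *
      ∑ β : Fin N, ∑ β' : Fin N, Real.cos (θConst N j β β') *
        ((if β = β' then χq - χκ + (if j = 0 then (N : ℝ) * χκ else 0) else χc) *
          ψper N K k β β') =
      χc * (N : ℝ) ^ 2 * ((if j = k then Real.cos (θConst N j α α') else 0) -
        T⁻¹ * (cConst N j * Real.cos (θConst N j α α'))) := by
    intro j hj
    have e : ∑ β : Fin N, ∑ β' : Fin N, Real.cos (θConst N j β β') *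
        ((if β = β' then χq - χκ + (if j = 0 then (N : ℝ) * χκ else 0) else χc) *
          ψper N K k β β') =
        χc * ∑ β : Fin N, ∑ β' : Fin N, Real.cos (θConst N j β β') * ψper N K k β β' := by
      simp only [Finset.mul_sum]
      refine Finset.sum_congr rfl fun β _ => Finset.sum_congr rfl fun β' _ => ?_
      by_cases h : β = β'
      · subst h; simp [hdiag]
      · simp only [h, if_false]; ring
    rw [e]
    have h := hcoef j hj
    have : (if j = k then Real.cos (θConst N j α α') else 0) =
      (if j = k then 1 else 0) * Real.cos (θConst N j α α') := by split_ifs <;> ring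
    rw [this]
    linear_combination χc * Real.cos (θConst N j α α') * h
  simp only [Jmap, Matrix.of_apply, Matrix.smul_apply, smul_eq_mul]
  rw [Finset.sum_congr rfl hin, ← Finset.mul_sum, Finset.sum_sub_distrib, ← Finset.mul_sum,
    Finset.sum_ite_eq', if_pos (Finset.mem_range.2 hk)]
  simp only [ψper, Matrix.of_apply, ← hT]
  field_simp
end

section
/- (Eigenmatrices of the linearized backpropagation map.) Let N ≥ 2 be even, K an integer with 1 ≤ K ≤ N/2 + 1, and χ_{c*} a real parameter. Define the linear map T̃ : ℝ^{N×N} → ℝ^{N×N} by [T̃(S)]_{α,α'} := (χ_{c*}/N²) ∑_{β=0}^{N−1} ∑_{β'=0}^{N−1} ( ∑_{k'=0}^{K−1} c_{k'} cos( (2πk'/N)((β − β') − (α − α')) ) ) S_{β,β'}. For k ∈ {0, …, K−1} define Ψ^{(k)} ∈ ℝ^{N×N} by Ψ^{(k)}_{α,α'} := cos(θ^{(k)}_{α,α'}). Then T̃(Ψ^{(k)}) = χ_{c*} Ψ^{(k)} for every k ∈ {0, …, K−1}. -/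
open Real Finset

/-- The linearized backpropagation map `T̃` of the simplified FNO:
`[T̃(S)]_{α,α'} = (χ_{c*}/N²) ∑_{β,β'} (∑_{k'<K} c_{k'} cos((2πk'/N)((β-β')-(α-α')))) S_{β,β'}`. -/
noncomputable def Tmap (N K : ℕ) (χc : ℝ)
    (S : Matrix (Fin N) (Fin N) ℝ) : Matrix (Fin N) (Fin N) ℝ :=
  Matrix.of fun α α' =>
    χc / (N : ℝ) ^ 2 * ∑ β : Fin N, ∑ β' : Fin N,
      (∑ k' ∈ Finset.range K, cConst N k' *
        Real.cos (2 * π * (k' : ℝ) / (N : ℝ) *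
          (((β : ℝ) - (β' : ℝ)) - ((α : ℝ) - (α' : ℝ))))) * S β β'

/-- The cosine matrix `Ψ^{(k)}_{α,α'} = cos(θ^{(k)}_{α,α'})`. -/
noncomputable def Ψcos (N k : ℕ) : Matrix (Fin N) (Fin N) ℝ :=
  Matrix.of fun α α' => Real.cos (θConst N k α α')


lemma aux_sum_zero (N : ℕ) (hN : 2 ≤ N) (m : ℤ) (hm : ¬ (N : ℤ) ∣ m) (ψ : ℝ) :
    ∑ β : Fin N, Real.cos (2 * π * (m : ℝ) / (N : ℝ) * (β : ℝ) + ψ) = 0 := by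
  have hN0 : (N : ℂ) ≠ 0 := by
    have : N ≠ 0 := by omega
    exact_mod_cast this
  set ζ : ℂ := Complex.exp (2 * π * Complex.I * m / N) with hζ
  have hζN : ζ ^ N = 1 := by
    rw [hζ, ← Complex.exp_nat_mul, Complex.exp_eq_one_iff]
    exact ⟨m, by field_simp⟩
  have hζ1 : ζ ≠ 1 := by
    intro h
    rw [hζ, Complex.exp_eq_one_iff] at h
    obtain ⟨n, hn⟩ := h
    apply hm
    refine ⟨n, ?_⟩
    have hpi : (2 * π * Complex.I : ℂ) ≠ 0 := Complex.two_pi_I_ne_zero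
    have h2 : (2 * π * Complex.I : ℂ) * m = (2 * π * Complex.I) * (N * n) := by
      rw [div_eq_iff hN0] at hn
      rw [hn]; ring
    have h3 := mul_left_cancel₀ hpi h2
    exact_mod_cast h3
  have hg : ∑ β ∈ Finset.range N, ζ ^ β = 0 := by
    rw [geom_sum_eq hζ1, hζN]; simp
  rw [Fin.sum_univ_eq_sum_range (fun β : ℕ => Real.cos (2 * π * (m : ℝ) / (N : ℝ) * (β : ℝ) + ψ))]
  have key : ∀ β : ℕ, Real.cos (2 * π * (m : ℝ) / (N : ℝ) * (β : ℝ) + ψ)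
      = (ζ ^ β * Complex.exp (ψ * Complex.I)).re := by
    intro β
    rw [hζ, ← Complex.exp_nat_mul, ← Complex.exp_add, ← Complex.exp_ofReal_mul_I_re]
    congr 2
    push_cast
    ring
  simp_rw [key]
  rw [← Complex.re_sum, ← Finset.sum_mul, hg]
  simp

lemma aux_sum_dvd (N : ℕ) (hN : 2 ≤ N) (m : ℤ) (hm : (N : ℤ) ∣ m) (φ : ℝ) (a b : Fin N) :
    Real.cos (2 * π * (m : ℝ) / (N : ℝ) * ((a : ℝ) - (b : ℝ)) + φ) = Real.cos φ := by
  obtain ⟨n, rfl⟩ := hm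
  have hN0 : (N : ℝ) ≠ 0 := by
    have : N ≠ 0 := by omega
    exact_mod_cast this
  rw [← Real.cos_add_int_mul_two_pi φ (n * ((a : ℕ) - (b : ℕ) : ℤ))]
  congr 1
  push_cast
  field_simp
  ring

lemma aux_double (N : ℕ) (hN : 2 ≤ N) (m : ℤ) (φ : ℝ) :
    ∑ β : Fin N, ∑ β' : Fin N,
      Real.cos (2 * π * (m : ℝ) / (N : ℝ) * ((β : ℝ) - (β' : ℝ)) + φ)
      = if (N : ℤ) ∣ m then (N : ℝ) ^ 2 * Real.cos φ else 0 := by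
  split_ifs with h
  · simp_rw [aux_sum_dvd N hN m h]
    simp
    ring
  · rw [Finset.sum_comm]
    apply Finset.sum_eq_zero
    intro b _
    rw [← aux_sum_zero N hN m h (φ - 2 * π * (m : ℝ) / (N : ℝ) * (b : ℝ))]
    apply Finset.sum_congr rfl
    intro a _
    congr 1
    ring

lemma aux_pair (N : ℕ) (hN : 2 ≤ N) (hNeven : Even N) (k k' : ℕ) (hk : k ≤ N / 2)
    (hk' : k' ≤ N / 2) (δ : ℝ) :
    cConst N k' * ∑ β : Fin N, ∑ β' : Fin N,
      Real.cos (2 * π * (k' : ℝ) / (N : ℝ) * (((β : ℝ) - (β' : ℝ)) - δ)) *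
        Real.cos (2 * π * (k : ℝ) / (N : ℝ) * ((β : ℝ) - (β' : ℝ)))
      = if k' = k then (N : ℝ) ^ 2 * Real.cos (2 * π * (k : ℝ) / (N : ℝ) * δ) else 0 := by
  have hprod : ∀ β β' : Fin N,
      Real.cos (2 * π * (k' : ℝ) / (N : ℝ) * (((β : ℝ) - (β' : ℝ)) - δ)) *
        Real.cos (2 * π * (k : ℝ) / (N : ℝ) * ((β : ℝ) - (β' : ℝ)))
      = 1 / 2 * Real.cos (2 * π * (((k' : ℤ) + k : ℤ) : ℝ) / (N : ℝ) * ((β : ℝ) - (β' : ℝ))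
          + -(2 * π * (k' : ℝ) / (N : ℝ) * δ))
        + 1 / 2 * Real.cos (2 * π * (((k' : ℤ) - k : ℤ) : ℝ) / (N : ℝ) * ((β : ℝ) - (β' : ℝ))
          + -(2 * π * (k' : ℝ) / (N : ℝ) * δ)) := by
    intro β β'
    set A := 2 * π * (k' : ℝ) / (N : ℝ) * (((β : ℝ) - (β' : ℝ)) - δ) with hA
    set B := 2 * π * (k : ℝ) / (N : ℝ) * ((β : ℝ) - (β' : ℝ)) with hB
    have h1 : 2 * π * (((k' : ℤ) + k : ℤ) : ℝ) / (N : ℝ) * ((β : ℝ) - (β' : ℝ))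
          + -(2 * π * (k' : ℝ) / (N : ℝ) * δ) = A + B := by
      rw [hA, hB]; push_cast; ring
    have h2 : 2 * π * (((k' : ℤ) - k : ℤ) : ℝ) / (N : ℝ) * ((β : ℝ) - (β' : ℝ))
          + -(2 * π * (k' : ℝ) / (N : ℝ) * δ) = A - B := by
      rw [hA, hB]; push_cast; ring
    rw [h1, h2, Real.cos_add, Real.cos_sub]
    ring
  simp_rw [hprod, Finset.sum_add_distrib, ← Finset.mul_sum]
  rw [aux_double N hN, aux_double N hN, Real.cos_neg]
  obtain ⟨M, rfl⟩ := hNeven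
  have hM : (M + M) / 2 = M := by omega
  rw [hM] at hk hk'
  unfold cConst
  rw [hM]
  by_cases hkk : k' = k
  · subst hkk
    by_cases h0 : k' = 0 ∨ k' = M
    · have : ((M + M : ℕ) : ℤ) ∣ (k' : ℤ) + k' := by
        rcases h0 with h | h <;> subst h <;> simp
      rw [if_pos h0, if_pos this, if_pos (by simp), if_pos rfl]
      ring
    · have : ¬ ((M + M : ℕ) : ℤ) ∣ (k' : ℤ) + k' := by
        intro h
        have := Int.le_of_dvd (by omega) h
        omega
      rw [if_neg h0, if_neg this, if_pos (by simp), if_pos rfl]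
      ring
  · have h1 : ¬ ((M + M : ℕ) : ℤ) ∣ (k' : ℤ) + k := by
      intro h
      have := Int.le_of_dvd (by omega) h
      omega
    have h2 : ¬ ((M + M : ℕ) : ℤ) ∣ (k' : ℤ) - k := by
      intro h
      have := Int.eq_zero_of_abs_lt_dvd h (by rw [abs_lt]; omega)
      omega
    rw [if_neg h1, if_neg h2, if_neg hkk]
    simp

/-- Eigenmatrices of the linearized backpropagation map:
`T̃(Ψ^{(k)}) = χ_{c*} Ψ^{(k)}` for every `k ∈ {0, …, K-1}`. -/
theorem stmt12 (N K : ℕ) (hN : 2 ≤ N) (hNeven : Even N) (hK1 : 1 ≤ K)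
    (hK : K ≤ N / 2 + 1) (χc : ℝ) :
    ∀ k : ℕ, k < K → Tmap N K χc (Ψcos N k) = χc • Ψcos N k := by
  intro k hk
  have hN0 : (N : ℝ) ≠ 0 := by
    have : N ≠ 0 := by omega
    exact_mod_cast this
  ext α α'
  simp only [Tmap, Ψcos, θConst, Matrix.of_apply, Matrix.smul_apply, smul_eq_mul]
  have hswap : ∑ β : Fin N, ∑ β' : Fin N,
      (∑ k' ∈ Finset.range K, cConst N k' *
        Real.cos (2 * π * (k' : ℝ) / (N : ℝ) *
          (((β : ℝ) - (β' : ℝ)) - ((α : ℝ) - (α' : ℝ))))) *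
        Real.cos (2 * π * (k : ℝ) / (N : ℝ) * ((β : ℝ) - (β' : ℝ)))
      = ∑ k' ∈ Finset.range K, cConst N k' * ∑ β : Fin N, ∑ β' : Fin N,
        Real.cos (2 * π * (k' : ℝ) / (N : ℝ) *
          (((β : ℝ) - (β' : ℝ)) - ((α : ℝ) - (α' : ℝ)))) *
        Real.cos (2 * π * (k : ℝ) / (N : ℝ) * ((β : ℝ) - (β' : ℝ))) := by
    simp_rw [Finset.mul_sum, Finset.sum_mul]
    symm
    rw [Finset.sum_comm]
    refine Finset.sum_congr rfl fun β _ => ?_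
    rw [Finset.sum_comm]
    simp_rw [mul_assoc]
  rw [hswap, Finset.sum_congr rfl (fun k' hk' => aux_pair N hN hNeven k k' (by omega)
    (by have := Finset.mem_range.mp hk'; omega) _), Finset.sum_ite_eq', if_pos (Finset.mem_range.mpr hk)]
  field_simp
end

section
/- (Theorem 3.2, trainability: gradient covariance propagation under the linearized backpropagation dynamics.) Let N ≥ 2 be even, K an integer with 1 ≤ K ≤ N/2 + 1, and χ_{c*} a real parameter. Define T̃ : ℝ^{N×N} → ℝ^{N×N} by [T̃(S)]_{α,α'} := (χ_{c*}/N²) ∑_{β=0}^{N−1} ∑_{β'=0}^{N−1} ( ∑_{k'=0}^{K−1} c_{k'} cos( (2πk'/N)((β − β') − (α − α')) ) ) S_{β,β'}, and for k ∈ {0, …, K−1} let Ψ^{(k)} ∈ ℝ^{N×N} with Ψ^{(k)}_{α,α'} := cos(θ^{(k)}_{α,α'}). Suppose S = ∑_{k=0}^{K−1} ε̃_k Ψ^{(k)} + ẽ with real scalars ε̃_0, …, ε̃_{K−1} and ẽ ∈ ℝ^{N×N} satisfying T̃(ẽ) = 0. Then for every integer m ≥ 1, the m-fold iterate satisfies T̃^{∘m}(S)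 = ∑_{k=0}^{K−1} χ_{c*}^m ε̃_k Ψ^{(k)}. -/
open Real Finset

lemma expsum_aux (N : ℕ) (hN : 2 ≤ N) (j : ℤ) :
    (∑ β : Fin N, Complex.exp (((2 * π * (j : ℝ) / (N : ℝ) * (β : ℝ) : ℝ) : ℂ) * Complex.I))
      = if (N : ℤ) ∣ j then (N : ℂ) else 0 := by
  have hN0 : (N : ℂ) ≠ 0 := by
    have : N ≠ 0 := by omega
    exact_mod_cast this
  set z : ℂ := Complex.exp (2 * π * Complex.I * ((j : ℂ) / N)) with hz
  have h1 : ∀ β : Fin N,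
      Complex.exp (((2 * π * (j : ℝ) / (N : ℝ) * (β : ℝ) : ℝ) : ℂ) * Complex.I)
        = z ^ (β : ℕ) := by
    intro β
    rw [hz, ← Complex.exp_nat_mul]
    congr 1
    push_cast
    ring
  rw [Finset.sum_congr rfl (fun β _ => h1 β), Fin.sum_univ_eq_sum_range (fun i => z ^ i) N]
  have hzN : z ^ N = 1 := by
    rw [hz, ← Complex.exp_nat_mul, Complex.exp_eq_one_iff]
    exact ⟨j, by field_simp⟩
  have hz1 : z = 1 ↔ (N : ℤ) ∣ j := by
    rw [hz, Complex.exp_eq_one_iff]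
    constructor
    · rintro ⟨n, hn⟩
      refine ⟨n, ?_⟩
      have hp := Complex.two_pi_I_ne_zero
      rw [mul_comm (n : ℂ)] at hn
      have := mul_left_cancel₀ hp hn
      rw [div_eq_iff hN0] at this
      have h3 : (j : ℂ) = (((N : ℤ) * n : ℤ) : ℂ) := by
        push_cast; rw [this]; ring
      exact_mod_cast h3
    · rintro ⟨n, rfl⟩
      refine ⟨n, ?_⟩
      push_cast
      field_simp
  split_ifs with h
  · rw [hz1.2 h]; simp
  · have hne : z ≠ 1 := fun h' => h (hz1.1 h')
    rw [geom_sum_eq hne, hzN]; simp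

lemma cossum_aux (N : ℕ) (hN : 2 ≤ N) (j : ℤ) (φ : ℝ) :
    (∑ β : Fin N, ∑ β' : Fin N,
      Real.cos (2 * π * (j : ℝ) / (N : ℝ) * ((β : ℝ) - (β' : ℝ)) - φ))
      = if (N : ℤ) ∣ j then (N : ℝ) ^ 2 * Real.cos φ else 0 := by
  have h := expsum_aux N hN j
  set w : ℝ := 2 * π * (j : ℝ) / (N : ℝ) with hw
  have hC : (∑ β : Fin N, Real.cos (w * (β : ℝ))) = if (N : ℤ) ∣ j then (N : ℝ) else 0 := by
    have := congrArg Complex.re h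
    rw [Complex.re_sum] at this
    simp only [Complex.exp_ofReal_mul_I_re] at this
    rw [this]; split_ifs <;> simp
  have hD : (∑ β : Fin N, Real.sin (w * (β : ℝ))) = 0 := by
    have := congrArg Complex.im h
    rw [Complex.im_sum] at this
    simp only [Complex.exp_ofReal_mul_I_im] at this
    rw [this]; split_ifs <;> simp
  have key : ∀ β β' : Fin N, Real.cos (w * ((β : ℝ) - (β' : ℝ)) - φ)
      = Real.cos φ * (Real.cos (w * β) * Real.cos (w * β'))
        + Real.cos φ * (Real.sin (w * β) * Real.sin (w * β'))
        + Real.sin φ * (Real.sin (w * β) * Real.cos (w * β'))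
        - Real.sin φ * (Real.cos (w * β) * Real.sin (w * β')) := by
    intro β β'
    rw [mul_sub, Real.cos_sub, Real.cos_sub, Real.sin_sub]; ring
  simp only [key, Finset.sum_add_distrib, Finset.sum_sub_distrib, ← Finset.mul_sum,
    ← Finset.sum_mul, hC, hD]
  split_ifs <;> ring

lemma cosprod_aux (N : ℕ) (hN : 2 ≤ N) (hNeven : Even N) (k k' : ℕ) (hk : k ≤ N / 2)
    (hk' : k' ≤ N / 2) (d : ℝ) :
    (∑ β : Fin N, ∑ β' : Fin N, cConst N k' *
        Real.cos (2 * π * (k' : ℝ) / (N : ℝ) * (((β : ℝ) - (β' : ℝ)) - d)) *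
        Real.cos (2 * π * (k : ℝ) / (N : ℝ) * ((β : ℝ) - (β' : ℝ))))
      = if k' = k then (N : ℝ) ^ 2 * Real.cos (2 * π * (k : ℝ) / (N : ℝ) * d) else 0 := by
  have key : ∀ β β' : Fin N, cConst N k' *
        Real.cos (2 * π * (k' : ℝ) / (N : ℝ) * (((β : ℝ) - (β' : ℝ)) - d)) *
        Real.cos (2 * π * (k : ℝ) / (N : ℝ) * ((β : ℝ) - (β' : ℝ)))
      = cConst N k' / 2 * (Real.cos (2 * π * (((k' : ℤ) - k : ℤ) : ℝ) / (N : ℝ) *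
            ((β : ℝ) - (β' : ℝ)) - 2 * π * (k' : ℝ) / (N : ℝ) * d)
        + Real.cos (2 * π * (((k' : ℤ) + k : ℤ) : ℝ) / (N : ℝ) *
            ((β : ℝ) - (β' : ℝ)) - 2 * π * (k' : ℝ) / (N : ℝ) * d)) := by
    intro β β'
    have e1 : 2 * π * (((k' : ℤ) - k : ℤ) : ℝ) / (N : ℝ) *
            ((β : ℝ) - (β' : ℝ)) - 2 * π * (k' : ℝ) / (N : ℝ) * d
        = 2 * π * (k' : ℝ) / (N : ℝ) * (((β : ℝ) - (β' : ℝ)) - d)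
          - 2 * π * (k : ℝ) / (N : ℝ) * ((β : ℝ) - (β' : ℝ)) := by push_cast; ring
    have e2 : 2 * π * (((k' : ℤ) + k : ℤ) : ℝ) / (N : ℝ) *
            ((β : ℝ) - (β' : ℝ)) - 2 * π * (k' : ℝ) / (N : ℝ) * d
        = 2 * π * (k' : ℝ) / (N : ℝ) * (((β : ℝ) - (β' : ℝ)) - d)
          + 2 * π * (k : ℝ) / (N : ℝ) * ((β : ℝ) - (β' : ℝ)) := by push_cast; ring
    rw [e1, e2, Real.cos_sub, Real.cos_add]; ring
  simp only [key, ← Finset.mul_sum, Finset.sum_add_distrib]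
  rw [cossum_aux N hN, cossum_aux N hN]
  obtain ⟨M, hM⟩ := hNeven
  have d1 : (N : ℤ) ∣ ((k' : ℤ) - k) ↔ k' = k := by
    constructor
    · intro h
      have := Int.eq_zero_of_abs_lt_dvd h (by rw [abs_lt]; constructor <;> omega)
      omega
    · rintro rfl; simp
  have d2 : (N : ℤ) ∣ ((k' : ℤ) + k) ↔ (k' = k ∧ (k' = 0 ∨ k' = N / 2)) := by
    constructor
    · rintro ⟨c, hc⟩
      have h0 : 0 ≤ c := by nlinarith
      have h2 : c < 2 := by
        by_contra hcon
        have : (N : ℤ) * 2 ≤ N * c := by nlinarith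
        omega
      interval_cases c <;> omega
    · rintro ⟨rfl, h | h⟩
      · simp [h]
      · exact ⟨1, by omega⟩
  simp only [d1, d2]
  unfold cConst
  by_cases h : k' = k
  · subst h
    by_cases h' : k' = 0 ∨ k' = N / 2 <;> simp only [h', and_self, and_false, if_true, if_false] <;> ring
  · simp [h]

lemma Tmap_add_aux (N K : ℕ) (χc : ℝ) (A B : Matrix (Fin N) (Fin N) ℝ) :
    Tmap N K χc (A + B) = Tmap N K χc A + Tmap N K χc B := by
  ext α α'
  simp only [Tmap, Matrix.of_apply, Matrix.add_apply, mul_add, Finset.sum_add_distrib]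

lemma Tmap_smul_aux (N K : ℕ) (χc a : ℝ) (A : Matrix (Fin N) (Fin N) ℝ) :
    Tmap N K χc (a • A) = a • Tmap N K χc A := by
  ext α α'
  simp only [Tmap, Matrix.of_apply, Matrix.smul_apply, smul_eq_mul, mul_left_comm _ a,
    ← Finset.mul_sum]

lemma Tmap_sum_aux (N K : ℕ) (χc : ℝ) (s : Finset ℕ) (f : ℕ → Matrix (Fin N) (Fin N) ℝ) :
    Tmap N K χc (∑ k ∈ s, f k) = ∑ k ∈ s, Tmap N K χc (f k) := by
  let L : Matrix (Fin N) (Fin N) ℝ →ₗ[ℝ] Matrix (Fin N) (Fin N) ℝ :=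
    { toFun := Tmap N K χc
      map_add' := Tmap_add_aux N K χc
      map_smul' := Tmap_smul_aux N K χc }
  exact map_sum L f s

lemma Tmap_Psi_aux (N K : ℕ) (hN : 2 ≤ N) (hNeven : Even N)
    (hK : K ≤ N / 2 + 1) (χc : ℝ) (k : ℕ) (hk : k < K) :
    Tmap N K χc (Ψcos N k) = χc • Ψcos N k := by
  ext α α'
  have hN0 : (N : ℝ) ≠ 0 := by
    have : N ≠ 0 := by omega
    exact_mod_cast this
  simp only [Tmap, Ψcos, θConst, Matrix.of_apply, Matrix.smul_apply, smul_eq_mul, Finset.sum_mul]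
  rw [Finset.sum_congr rfl (fun β _ => Finset.sum_comm), Finset.sum_comm]
  rw [Finset.sum_congr rfl (fun k' hk' => cosprod_aux N hN hNeven k k' (by omega)
    (by have := Finset.mem_range.1 hk'; omega) _)]
  rw [Finset.sum_ite_eq' , if_pos (Finset.mem_range.2 hk)]
  field_simp

/-- Theorem 3.2 (trainability): gradient covariance propagation under the linearized
backpropagation dynamics: if `S = ∑_{k<K} ε̃_k Ψ^{(k)} + ẽ` with `T̃(ẽ) = 0`, then
`T̃^{∘m}(S) = ∑_{k<K} χ_{c*}^m ε̃_k Ψ^{(k)}` for all `m ≥ 1`. -/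
theorem stmt14 (N K : ℕ) (hN : 2 ≤ N) (hNeven : Even N) (hK1 : 1 ≤ K)
    (hK : K ≤ N / 2 + 1) (χc : ℝ)
    (ε : ℕ → ℝ) (e : Matrix (Fin N) (Fin N) ℝ) (he : Tmap N K χc e = 0)
    (S : Matrix (Fin N) (Fin N) ℝ)
    (hS : S = (∑ k ∈ Finset.range K, ε k • Ψcos N k) + e)
    (m : ℕ) (hm : 1 ≤ m) :
    (Tmap N K χc)^[m] S = ∑ k ∈ Finset.range K, (χc ^ m * ε k) • Ψcos N k := by
  have step : ∀ a : ℕ → ℝ, Tmap N K χc (∑ k ∈ Finset.range K, a k • Ψcos N k)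
      = ∑ k ∈ Finset.range K, (χc * a k) • Ψcos N k := by
    intro a
    rw [Tmap_sum_aux]
    refine Finset.sum_congr rfl fun k hk => ?_
    rw [Tmap_smul_aux, Tmap_Psi_aux N K hN hNeven hK χc k (Finset.mem_range.1 hk), smul_smul,
      mul_comm]
  induction m, hm using Nat.le_induction with
  | base =>
    rw [Function.iterate_one, hS, Tmap_add_aux, he, add_zero, step]
    simp
  | succ n hn ih =>
    rw [Function.iterate_succ_apply', ih, step]
    refine Finset.sum_congr rfl fun k _ => ?_
    rw [pow_succ']
    ring_nf
end

section
/- (Closed form of the ReLU iterated correlation map, eq. (9)–(10).) Let γ denote the standard Gaussian measure N(0,1) on ℝ. For every real q > 0 and every c ∈ [−1, 1], ∫∫ max(0, √q z₁) · max(0, √q (c z₁ + √(1 − c²) z₂)) dγ(z₁) dγ(z₂) = (q/(2π)) ( √(1 − c²) + (π − arccos c) · c ). -/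
open Real MeasureTheory ProbabilityTheory

lemma angle_int (a : ℝ) (h0 : 0 ≤ a) (h1 : a ≤ π) :
    ∫ θ in Set.Ioo (-π) π, max 0 (cos θ) * max 0 (cos (θ - a))
      = 1 / 2 * (sin a + (π - a) * cos a) := by
  have hpi := Real.pi_pos
  have e : ∀ θ ∈ Set.Ioo (-π) π, max 0 (cos θ) * max 0 (cos (θ - a))
      = (Set.Icc (a - π / 2) (π / 2)).indicator (fun θ => cos θ * cos (θ - a)) θ := by
    intro θ hθ
    obtain ⟨hl, hr⟩ := hθ
    by_cases h : θ ∈ Set.Icc (a - π / 2) (π / 2)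
    · rw [Set.indicator_of_mem h]
      obtain ⟨h2, h3⟩ := h
      rw [max_eq_right (cos_nonneg_of_neg_pi_div_two_le_of_le (by linarith) h3),
        max_eq_right (cos_nonneg_of_neg_pi_div_two_le_of_le (by linarith) (by linarith))]
    · rw [Set.indicator_of_notMem h]
      by_cases h3 : θ ≤ π / 2
      · have h2 : θ < a - π / 2 := by
          by_contra h2
          exact h ⟨not_lt.mp h2, h3⟩
        by_cases h4 : θ ≤ - (π / 2)
        · have : cos θ ≤ 0 := by
            rw [← cos_neg]
            exact cos_nonpos_of_pi_div_two_le_of_le (by linarith) (by linarith)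
          rw [max_eq_left this, zero_mul]
        · have : cos (θ - a) ≤ 0 := by
            rw [← cos_neg]
            exact cos_nonpos_of_pi_div_two_le_of_le (by linarith) (by linarith)
          rw [max_eq_left this, mul_zero]
      · have : cos θ ≤ 0 :=
          cos_nonpos_of_pi_div_two_le_of_le (by linarith) (by linarith)
        rw [max_eq_left this, zero_mul]
  rw [setIntegral_congr_fun measurableSet_Ioo e, setIntegral_indicator measurableSet_Icc]
  have hs : Set.Ioo (-π) π ∩ Set.Icc (a - π / 2) (π / 2) = Set.Icc (a - π / 2) (π / 2) := by
    apply Set.inter_eq_right.mpr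
    intro x hx
    exact ⟨by linarith [hx.1], by linarith [hx.2]⟩
  rw [hs, integral_Icc_eq_integral_Ioc, ← intervalIntegral.integral_of_le (by linarith)]
  have hd : ∀ θ ∈ Set.uIcc (a - π / 2) (π / 2),
      HasDerivAt (fun θ => 1 / 2 * (θ * cos a + 1 / 2 * sin (2 * θ - a)))
        (cos θ * cos (θ - a)) θ := by
    intro θ _
    have hl : HasDerivAt (fun θ : ℝ => 2 * θ - a) 2 θ := by
      simpa using ((hasDerivAt_id θ).const_mul 2).sub_const a
    have h := ((((hasDerivAt_id θ).mul_const (cos a)).add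
      (hl.sin.const_mul (1 / 2))).const_mul (1 / 2))
    refine h.congr_deriv ?_
    have e1 : cos a = cos (θ - (θ - a)) := by congr 1; ring
    have e2 : cos (2 * θ - a) = cos (θ + (θ - a)) := by congr 1; ring
    rw [e2, e1, cos_add, cos_sub θ (θ - a)]
    ring
  rw [intervalIntegral.integral_eq_sub_of_hasDerivAt hd
    (Continuous.intervalIntegrable (by fun_prop) _ _)]
  have e1 : sin (2 * (π / 2) - a) = sin a := by
    rw [show 2 * (π / 2) - a = π - a by ring, sin_pi_sub]
  have e2 : sin (2 * (a - π / 2) - a) = - sin a := by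
    rw [show 2 * (a - π / 2) - a = a - π by ring, sin_sub_pi]
  rw [e1, e2]
  ring

lemma radial_int : ∫ r in Set.Ioi (0 : ℝ), r ^ 3 * exp (-(r ^ 2 / 2)) = 2 := by
  have h := integral_rpow_mul_exp_neg_mul_rpow (p := 2) (q := 3) (b := 1 / 2)
    (by norm_num) (by norm_num) (by norm_num)
  have e : ∀ r ∈ Set.Ioi (0 : ℝ), r ^ 3 * exp (-(r ^ 2 / 2))
      = r ^ (3 : ℝ) * exp (-(1 / 2) * r ^ (2 : ℝ)) := by
    intro r _
    have h3 : r ^ (3 : ℝ) = r ^ 3 := by exact_mod_cast rpow_natCast r 3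
    have h2 : r ^ (2 : ℝ) = r ^ 2 := by exact_mod_cast rpow_natCast r 2
    rw [h3, h2]
    congr 2
    ring
  rw [setIntegral_congr_fun measurableSet_Ioi e, h]
  have g : ((3 : ℝ) + 1) / 2 = 2 := by norm_num
  have g' : -((3 : ℝ) + 1) / 2 = -2 := by norm_num
  rw [g, g', Gamma_two, rpow_neg (by norm_num)]
  norm_num

theorem stmt16 (q : ℝ) (hq : 0 < q) (c : ℝ) (hc : c ∈ Set.Icc (-1 : ℝ) 1) :
    (∫ p : ℝ × ℝ, max 0 (Real.sqrt q * p.1) *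
        max 0 (Real.sqrt q * (c * p.1 + Real.sqrt (1 - c ^ 2) * p.2))
      ∂((gaussianReal 0 1).prod (gaussianReal 0 1)))
      = q / (2 * π) * (Real.sqrt (1 - c ^ 2) + (π - Real.arccos c) * c) := by
  have hpi := Real.pi_pos
  have hca : cos (arccos c) = c := cos_arccos hc.1 hc.2
  have hsa : sin (arccos c) = √(1 - c ^ 2) := sin_arccos c
  rw [← hsa]
  rw [gaussianReal_of_var_ne_zero 0 one_ne_zero,
    prod_withDensity (measurable_gaussianPDF 0 1) (measurable_gaussianPDF 0 1),
    integral_withDensity_eq_integral_toReal_smul (by fun_prop)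
      (by filter_upwards with p
          exact ENNReal.mul_lt_top gaussianPDF_lt_top gaussianPDF_lt_top),
    ← Measure.volume_eq_prod, ← integral_comp_polarCoord_symm]
  have e : ∀ p ∈ polarCoord.target,
      p.1 • ((gaussianPDF 0 1 (polarCoord.symm p).1 * gaussianPDF 0 1 (polarCoord.symm p).2).toReal
        • (max 0 (√q * (polarCoord.symm p).1) *
        max 0 (√q * (c * (polarCoord.symm p).1 + sin (arccos c) * (polarCoord.symm p).2))))
      = (q / (2 * π) * (p.1 ^ 3 * exp (-(p.1 ^ 2 / 2)))) *
        (max 0 (cos p.2) * max 0 (cos (p.2 - arccos c))) := by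
    rintro ⟨r, θ⟩ ⟨hr, _⟩
    have hr : 0 < r := hr
    have m : ∀ x : ℝ, max 0 (√q * (r * x)) = √q * r * max 0 x := by
      intro x
      rw [mul_max_of_nonneg _ _ (by positivity), mul_zero, mul_assoc]
    have hx : c * (r * cos θ) + sin (arccos c) * (r * sin θ) = r * cos (θ - arccos c) := by
      rw [cos_sub, hca]; ring
    have hg : gaussianPDFReal 0 1 (r * cos θ) * gaussianPDFReal 0 1 (r * sin θ)
        = 1 / (2 * π) * exp (-(r ^ 2 / 2)) := by
      simp only [gaussianPDFReal, NNReal.coe_one, mul_one, sub_zero]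
      rw [mul_mul_mul_comm, ← exp_add, ← mul_inv, mul_self_sqrt (by positivity), one_div]
      congr 2
      linear_combination (-r ^ 2 / 2) * sin_sq_add_cos_sq θ
    simp only [polarCoord_symm_apply, ENNReal.toReal_mul, toReal_gaussianPDF, smul_eq_mul]
    rw [hx, m, m, hg]
    have hqq := mul_self_sqrt hq.le
    linear_combination (r ^ 3 * (1 / (2 * π) * exp (-(r ^ 2 / 2))) *
        (max 0 (cos θ) * max 0 (cos (θ - arccos c)))) * hqq
  have ht : polarCoord.target = Set.Ioi (0 : ℝ) ×ˢ Set.Ioo (-π) π := rfl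
  rw [setIntegral_congr_fun polarCoord.open_target.measurableSet e, ht, Measure.volume_eq_prod,
    setIntegral_prod_mul (fun r : ℝ => q / (2 * π) * (r ^ 3 * exp (-(r ^ 2 / 2))))
      (fun θ => max 0 (cos θ) * max 0 (cos (θ - arccos c))),
    integral_const_mul, radial_int, angle_int _ (arccos_nonneg c) (arccos_le_pi c), hca]
  ring
end

section
/- (Correlated Gaussian quadrant probability; this gives χ_{c*} = σ²/2 for ReLU at c* = 1 and hence the He-initialization edge of chaos σ² = 2.) Let γ denote the standard Gaussian measure N(0,1) on ℝ. For every c ∈ [−1, 1], the γ ⊗ γ-measure of the set {(z₁, z₂) ∈ ℝ² : z₁ > 0 and c z₁ + √(1 − c²) z₂ > 0} equals (π − arccos c)/(2π). In particular, for c = 1 this probability equals 1/2, so 2 · (γ ⊗ γ)({z₁ > 0 and z₁ > 0}) = 1. -/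
open Real MeasureTheory ProbabilityTheory

lemma polar_aux : ∃ K : ENNReal, ∀ S : Set (ℝ × ℝ), ∀ A : Set ℝ, MeasurableSet S →
    MeasurableSet A →
    (∀ r : ℝ, 0 < r → ∀ t ∈ Set.Ioo (-π) π, ((r * cos t, r * sin t) ∈ S ↔ t ∈ A)) →
    ((gaussianReal 0 1).prod (gaussianReal 0 1)) S = K * volume (A ∩ Set.Ioo (-π) π) := by
  refine ⟨∫⁻ r in Set.Ioi (0:ℝ), ENNReal.ofReal (r * ((√(2 * π))⁻¹ * (√(2 * π))⁻¹ *
    rexp (-r ^ 2 / 2))), ?_⟩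
  intro S A hS hA h
  have hpdf : Measurable (gaussianPDF 0 1) := measurable_gaussianPDF 0 1
  have h1 : volume (A ∩ Set.Ioo (-π) π) =
      ∫⁻ t in Set.Ioo (-π) π, A.indicator (fun _ => (1 : ENNReal)) t := by
    rw [lintegral_indicator hA, setLIntegral_one, Measure.restrict_apply hA]
  rw [gaussianReal_of_var_ne_zero 0 one_ne_zero, prod_withDensity hpdf hpdf,
    withDensity_apply _ hS, ← lintegral_indicator hS, ← Measure.volume_eq_prod,
    ← lintegral_comp_polarCoord_symm, h1, ← lintegral_prod_mul (by fun_prop)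
      ((measurable_const.indicator hA).aemeasurable), Measure.prod_restrict,
      ← Measure.volume_eq_prod]
  refine setLIntegral_congr_fun polarCoord.open_target.measurableSet ?_
  rintro ⟨r, t⟩ ⟨hr, ht⟩
  have hr' : 0 < r := hr
  have key := h r hr' t ht
  have hp : polarCoord.symm (r, t) = (r * cos t, r * sin t) := rfl
  simp only [hp, smul_eq_mul]
  by_cases hA' : t ∈ A
  · rw [Set.indicator_of_mem (key.2 hA'), Set.indicator_of_mem hA', mul_one]
    simp only [gaussianPDF, gaussianPDFReal]
    rw [← ENNReal.ofReal_mul (by positivity), ← ENNReal.ofReal_mul hr'.le]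
    congr 2
    rw [mul_mul_mul_comm, ← Real.exp_add]
    simp only [NNReal.coe_one, mul_one, sub_zero]
    congr 2
    have := sin_sq_add_cos_sq t
    linear_combination (-r ^ 2 / 2) * this
  · rw [Set.indicator_of_notMem (fun hh => hA' (key.1 hh)), Set.indicator_of_notMem hA']
    simp

lemma quadrant_aux (c : ℝ) (hc : c ∈ Set.Icc (-1 : ℝ) 1) :
    ((gaussianReal 0 1).prod (gaussianReal 0 1))
        {p : ℝ × ℝ | 0 < p.1 ∧ 0 < c * p.1 + Real.sqrt (1 - c ^ 2) * p.2}
      = ENNReal.ofReal ((π - Real.arccos c) / (2 * π)) := by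
  obtain ⟨K, hK⟩ := polar_aux
  have hpi := Real.pi_pos
  have h1 := hK Set.univ Set.univ .univ .univ (by simp)
  rw [measure_univ, Set.univ_inter, Real.volume_Ioo] at h1
  have hKv : K = (ENNReal.ofReal (2 * π))⁻¹ := by
    apply ENNReal.eq_inv_of_mul_eq_one_left
    rw [h1]; congr 2; ring
  have h0 := arccos_nonneg c
  have h2 := arccos_le_pi c
  have hS : MeasurableSet {p : ℝ × ℝ | 0 < p.1 ∧ 0 < c * p.1 + Real.sqrt (1 - c ^ 2) * p.2} := by
    apply MeasurableSet.inter
    · exact measurableSet_lt measurable_const measurable_fst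
    · have hm : Measurable (fun p : ℝ × ℝ => c * p.1 + Real.sqrt (1 - c ^ 2) * p.2) := by fun_prop
      exact measurableSet_lt measurable_const hm
  rw [hK _ (Set.Ioo (arccos c - π / 2) (π / 2)) hS measurableSet_Ioo, Set.inter_eq_left.2,
    Real.volume_Ioo, hKv, ENNReal.ofReal_div_of_pos (by positivity), mul_comm, div_eq_mul_inv]
  · congr 2; ring
  · apply Set.Ioo_subset_Ioo <;> linarith
  · rintro r hr t ⟨ht1, ht2⟩
    have e : c * (r * cos t) + √(1 - c ^ 2) * (r * sin t) = r * cos (t - arccos c) := by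
      rw [cos_sub, cos_arccos hc.1 hc.2, sin_arccos]; ring
    simp only [Set.mem_ofPred_eq, e, mul_pos_iff_of_pos_left hr, Set.mem_Ioo]
    constructor
    · rintro ⟨ha, hb⟩
      have k1 : t < π / 2 := by
        by_contra! hh
        exact absurd ha (not_lt.2 (cos_nonpos_of_pi_div_two_le_of_le hh (by linarith)))
      have k2 : -(π / 2) < t := by
        by_contra! hh
        rw [← cos_neg] at ha
        exact absurd ha (not_lt.2 (cos_nonpos_of_pi_div_two_le_of_le (by linarith) (by linarith)))
      refine ⟨?_, k1⟩
      by_contra! hh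
      rw [← cos_neg] at hb
      exact absurd hb (not_lt.2 (cos_nonpos_of_pi_div_two_le_of_le (by linarith) (by linarith)))
    · rintro ⟨ha, hb⟩
      exact ⟨cos_pos_of_mem_Ioo ⟨by linarith, hb⟩, cos_pos_of_mem_Ioo ⟨by linarith, by linarith⟩⟩

/-- Correlated Gaussian quadrant probability:
`(γ ⊗ γ)({z₁ > 0 ∧ c z₁ + √(1-c²) z₂ > 0}) = (π - arccos c)/(2π)`; in particular for
`c = 1` the probability is `1/2`, i.e. `2 (γ ⊗ γ)({z₁ > 0 ∧ z₁ > 0}) = 1`. -/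
theorem stmt17 (c : ℝ) (hc : c ∈ Set.Icc (-1 : ℝ) 1) :
    ((gaussianReal 0 1).prod (gaussianReal 0 1))
        {p : ℝ × ℝ | 0 < p.1 ∧ 0 < c * p.1 + Real.sqrt (1 - c ^ 2) * p.2}
      = ENNReal.ofReal ((π - Real.arccos c) / (2 * π)) ∧
    2 * ((gaussianReal 0 1).prod (gaussianReal 0 1))
        {p : ℝ × ℝ | 0 < p.1 ∧ 0 < p.1} = 1 := by
  refine ⟨quadrant_aux c hc, ?_⟩
  have h := quadrant_aux 1 (by norm_num)
  have e : (π - Real.arccos 1) / (2 * π) = 2⁻¹ := by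
    have := Real.pi_pos
    rw [arccos_one]; field_simp; ring
  have e2 : {p : ℝ × ℝ | 0 < p.1 ∧ 0 < (1:ℝ) * p.1 + Real.sqrt (1 - 1 ^ 2) * p.2} =
      {p : ℝ × ℝ | 0 < p.1 ∧ 0 < p.1} := by
    ext p; simp
  rw [e, e2] at h
  rw [h, ENNReal.ofReal_inv_of_pos (by norm_num), ENNReal.ofReal_ofNat]
  exact ENNReal.mul_inv_cancel (by norm_num) (by norm_num)
end

section
/- (Derivative of the correlation map in the correlation parameter: the convergence rate χ_{c*}.) Let γ denote the standard Gaussian measure N(0,1) on ℝ. Let φ : ℝ → ℝ be twice continuously differentiable with φ, φ', φ'' bounded, and let q > 0. Define G : (−1, 1) → ℝ by G(c) := ∫∫ φ(√q z₁) · φ(√q (c z₁ + √(1 − c²) z₂)) dγ(z₁) dγ(z₂). Then G is differentiable on (−1, 1) and for every c ∈ (−1, 1), G'(c) = q ∫∫ φ'(√q z₁) · φ'(√q (c z₁ + √(1 − c²) z₂)) dγ(z₁) dγ(z₂). -/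
open Real MeasureTheory ProbabilityTheory

lemma gauss_integrable_id_mul (f : ℝ → ℝ) (hf : Continuous f) (M : ℝ) (hM : ∀ x, |f x| ≤ M) :
    Integrable (fun x => x * f x) (gaussianReal 0 1) := by
  have h1 : Integrable (fun x : ℝ => x) (gaussianReal 0 1) :=
    (memLp_id_gaussianReal 1).integrable (by simp)
  exact h1.mul_bdd (c := M) hf.aestronglyMeasurable (Filter.Eventually.of_forall hM)

lemma gauss_integrable_pdf (f : ℝ → ℝ) (h : Integrable f (gaussianReal 0 1)) :
    Integrable (fun x => gaussianPDFReal 0 1 x * f x) := by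
  rw [gaussianReal_of_var_ne_zero 0 (one_ne_zero)] at h
  rw [integrable_withDensity_iff_integrable_smul' (measurable_gaussianPDF 0 1)
    (Filter.Eventually.of_forall fun x => gaussianPDF_lt_top)] at h
  simpa [toReal_gaussianPDF] using h

lemma gauss_pdf_deriv (x : ℝ) :
    HasDerivAt (gaussianPDFReal 0 1) (-x * gaussianPDFReal 0 1 x) x := by
  rw [gaussianPDFReal_def]
  have h : HasDerivAt (fun x : ℝ => -(x - 0) ^ 2 / (2 * ((1 : NNReal) : ℝ))) (-x) x := by
    have := (((hasDerivAt_id x).sub_const 0).pow 2).neg.div_const (2 * ((1 : NNReal) : ℝ))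
    refine HasDerivAt.congr_deriv (this) ?_
    simp; ring
  refine HasDerivAt.congr_deriv ((h.exp.const_mul (√(2 * π * ((1 : NNReal) : ℝ)))⁻¹)) ?_
  ring

lemma gauss_stein (f f' : ℝ → ℝ) (hf : ∀ x, HasDerivAt f (f' x) x) (hf' : Continuous f')
    (M : ℝ) (hM : ∀ x, |f x| ≤ M) (hM' : ∀ x, |f' x| ≤ M) :
    ∫ x, x * f x ∂(gaussianReal 0 1) = ∫ x, f' x ∂(gaussianReal 0 1) := by
  have hfc : Continuous f := continuous_iff_continuousAt.2 fun x => (hf x).continuousAt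
  have i1 := gauss_integrable_pdf _ (gauss_integrable_id_mul f hfc M hM)
  have i2 := gauss_integrable_pdf f
    (Integrable.of_bound hfc.aestronglyMeasurable M (Filter.Eventually.of_forall hM))
  have i3 := gauss_integrable_pdf f'
    (Integrable.of_bound hf'.aestronglyMeasurable M (Filter.Eventually.of_forall hM'))
  have key := integral_eq_zero_of_hasDerivAt_of_integrable
    (f := fun x => gaussianPDFReal 0 1 x * f x)
    (f' := fun x => gaussianPDFReal 0 1 x * f' x - gaussianPDFReal 0 1 x * (x * f x))
    (fun x => by
      refine HasDerivAt.congr_deriv ((gauss_pdf_deriv x).mul (hf x)) ?_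
      ring) (i3.sub i1) i2
  rw [integral_sub i3 i1] at key
  rw [integral_gaussianReal_eq_integral_smul one_ne_zero,
    integral_gaussianReal_eq_integral_smul one_ne_zero]
  simp only [smul_eq_mul]
  linarith

noncomputable abbrev gaussTwo : Measure (ℝ × ℝ) := (gaussianReal 0 1).prod (gaussianReal 0 1)

lemma gaussTwo_int_fst : Integrable (fun p : ℝ × ℝ => p.1) gaussTwo :=
  ((memLp_id_gaussianReal 1).integrable (by simp) :
    Integrable (fun x : ℝ => x) (gaussianReal 0 1)).comp_fst _

lemma gaussTwo_int_snd : Integrable (fun p : ℝ × ℝ => p.2) gaussTwo :=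
  ((memLp_id_gaussianReal 1).integrable (by simp) :
    Integrable (fun x : ℝ => x) (gaussianReal 0 1)).comp_snd _

lemma gaussTwo_int_bdd (F : ℝ × ℝ → ℝ) (hF : Continuous F) (M : ℝ) (hM : ∀ p, |F p| ≤ M) :
    Integrable F gaussTwo :=
  Integrable.of_bound hF.aestronglyMeasurable M (Filter.Eventually.of_forall hM)

lemma gaussTwo_stein_fst (F F' : ℝ × ℝ → ℝ) (hF : Continuous F) (hF' : Continuous F') (M M' : ℝ)
    (hM : ∀ p, |F p| ≤ M) (hM' : ∀ p, |F' p| ≤ M')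
    (hd : ∀ x y, HasDerivAt (fun t => F (t, y)) (F' (x, y)) x) :
    ∫ p, p.1 * F p ∂gaussTwo = ∫ p, F' p ∂gaussTwo := by
  rw [integral_prod_symm _ (gaussTwo_int_fst.mul_bdd (c := M) hF.aestronglyMeasurable
      (Filter.Eventually.of_forall hM)),
    integral_prod_symm _ (gaussTwo_int_bdd F' hF' M' hM')]
  congr 1
  ext y
  exact gauss_stein (fun x => F (x, y)) (fun x => F' (x, y)) (fun x => hd x y) (by fun_prop)
    (max M M') (fun x => (hM _).trans (le_max_left _ _)) (fun x => (hM' _).trans (le_max_right _ _))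

lemma gaussTwo_stein_snd (F F' : ℝ × ℝ → ℝ) (hF : Continuous F) (hF' : Continuous F') (M M' : ℝ)
    (hM : ∀ p, |F p| ≤ M) (hM' : ∀ p, |F' p| ≤ M')
    (hd : ∀ x y, HasDerivAt (fun t => F (x, t)) (F' (x, y)) y) :
    ∫ p, p.2 * F p ∂gaussTwo = ∫ p, F' p ∂gaussTwo := by
  rw [integral_prod _ (gaussTwo_int_snd.mul_bdd (c := M) hF.aestronglyMeasurable
      (Filter.Eventually.of_forall hM)),
    integral_prod _ (gaussTwo_int_bdd F' hF' M' hM')]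
  congr 1
  ext x
  exact gauss_stein (fun y => F (x, y)) (fun y => F' (x, y)) (fun y => hd x y) (by fun_prop)
    (max M M') (fun x => (hM _).trans (le_max_left _ _)) (fun x => (hM' _).trans (le_max_right _ _))

/-- Derivative of the correlation map in the correlation parameter (the convergence rate
`χ_{c*}`): for `φ` twice continuously differentiable with `φ, φ', φ''` bounded and `q > 0`,
the map `G(c) = ∫∫ φ(√q z₁) φ(√q (c z₁ + √(1-c²) z₂)) dγ(z₁) dγ(z₂)` is differentiable at
every `c ∈ (-1, 1)` with
`G'(c) = q ∫∫ φ'(√q z₁) φ'(√q (c z₁ + √(1-c²) z₂)) dγ(z₁) dγ(z₂)`. -/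
theorem stmt19 (φ : ℝ → ℝ) (hφ : ContDiff ℝ 2 φ)
    (hbdd : ∃ C : ℝ, ∀ x : ℝ,
      |φ x| ≤ C ∧ |deriv φ x| ≤ C ∧ |deriv (deriv φ) x| ≤ C)
    (q : ℝ) (hq : 0 < q) (c : ℝ) (hc : c ∈ Set.Ioo (-1 : ℝ) 1) :
    HasDerivAt (fun c' : ℝ => ∫ p : ℝ × ℝ, φ (Real.sqrt q * p.1) *
        φ (Real.sqrt q * (c' * p.1 + Real.sqrt (1 - c' ^ 2) * p.2))
      ∂((gaussianReal 0 1).prod (gaussianReal 0 1)))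
      (q * ∫ p : ℝ × ℝ, deriv φ (Real.sqrt q * p.1) *
        deriv φ (Real.sqrt q * (c * p.1 + Real.sqrt (1 - c ^ 2) * p.2))
      ∂((gaussianReal 0 1).prod (gaussianReal 0 1))) c := by
  obtain ⟨C, hC⟩ := hbdd
  have hC0 : 0 ≤ C := (abs_nonneg _).trans (hC 0).1
  have hd1 : ∀ x, HasDerivAt φ (deriv φ x) x := fun x =>
    ((hφ.differentiable (by norm_num)) x).hasDerivAt
  have hφ' : ContDiff ℝ 1 (deriv φ) := by
    have : ContDiff ℝ (1 + 1) φ := by norm_num; exact hφ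
    exact (contDiff_succ_iff_deriv.1 this).2.2
  have hd2 : ∀ x, HasDerivAt (deriv φ) (deriv (deriv φ) x) x := fun x =>
    ((hφ'.differentiable (by norm_num)) x).hasDerivAt
  have c0 : Continuous φ := hφ.continuous
  have c1 : Continuous (deriv φ) := hφ'.continuous
  have c2 : Continuous (deriv (deriv φ)) := hφ'.continuous_deriv (by norm_num)
  have h0 := fun x => (hC x).1
  have h1 := fun x => (hC x).2.1
  have h2 := fun x => (hC x).2.2
  clear hC hφ hφ'
  generalize deriv (deriv φ) = φ'' at *
  generalize deriv φ = φ' at *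
  obtain ⟨k, hk0, rfl⟩ : ∃ k : ℝ, 0 ≤ k ∧ q = k ^ 2 := ⟨√q, sqrt_nonneg _, (sq_sqrt hq.le).symm⟩
  rw [Real.sqrt_sq hk0]
  have hmulb : ∀ a b : ℝ, |a| ≤ C → |b| ≤ C → |a * b| ≤ C * C := fun a b ha hb => by
    rw [abs_mul]; exact mul_le_mul ha hb (abs_nonneg _) hC0
  have hca : |c| < 1 := abs_lt.2 hc
  obtain ⟨r, hcr, hr1⟩ := exists_between hca
  have hr0 : 0 ≤ r := (abs_nonneg c).trans hcr.le
  have hpos : ∀ x : ℝ, |x| < r → 0 < 1 - r ^ 2 ∧ 1 - r ^ 2 ≤ 1 - x ^ 2 := by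
    intro x hx
    have : x ^ 2 ≤ r ^ 2 := sq_le_sq' (by linarith [(abs_lt.1 hx).1]) (abs_lt.1 hx).2.le
    exact ⟨by nlinarith, by linarith⟩
  have hsder : ∀ x : ℝ, |x| < r → HasDerivAt (fun t : ℝ => √(1 - t ^ 2)) (-(x / √(1 - x ^ 2))) x := by
    intro x hx
    have h := hpos x hx
    have hh : HasDerivAt (fun t : ℝ => 1 - t ^ 2) (-(2 * x)) x := by
      have := ((hasDerivAt_id x).pow 2).const_sub 1
      refine HasDerivAt.congr_deriv (this) ?_
      simp
    refine HasDerivAt.congr_deriv (hh.sqrt (by linarith)) ?_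
    have : √(1 - x ^ 2) ≠ 0 := (Real.sqrt_pos.2 (by linarith)).ne'
    field_simp
  have main := hasDerivAt_integral_of_dominated_loc_of_deriv_le (μ := gaussTwo) (x₀ := c)
    (s := {x : ℝ | |x| < r})
    (F := fun x p => φ (k * p.1) * φ (k * (x * p.1 + √(1 - x ^ 2) * p.2)))
    (F' := fun x p => φ (k * p.1) * (φ' (k * (x * p.1 + √(1 - x ^ 2) * p.2)) *
      (k * (p.1 + -(x / √(1 - x ^ 2)) * p.2))))
    (bound := fun p => C * (C * (k * (|p.1| + (1 / √(1 - r ^ 2)) * |p.2|))))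
    ((isOpen_lt continuous_abs continuous_const).mem_nhds hcr)
    (Filter.Eventually.of_forall fun x => by
      apply Continuous.aestronglyMeasurable; fun_prop)
    (gaussTwo_int_bdd _ (by fun_prop) (C * C) fun p => hmulb _ _ (h0 _) (h0 _))
    (by apply Continuous.aestronglyMeasurable; fun_prop)
    (Filter.Eventually.of_forall fun p x hx => by
      have h := hpos x hx
      have hs1 : 0 < √(1 - r ^ 2) := Real.sqrt_pos.2 h.1
      have hs2 : √(1 - r ^ 2) ≤ √(1 - x ^ 2) := Real.sqrt_le_sqrt h.2
      have hx1 : |x| ≤ 1 := (lt_trans hx hr1).le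
      rw [Real.norm_eq_abs, abs_mul, abs_mul, abs_mul, abs_of_nonneg hk0]
      have hlast : |p.1 + -(x / √(1 - x ^ 2)) * p.2| ≤ |p.1| + (1 / √(1 - r ^ 2)) * |p.2| := by
        refine (abs_add_le _ _).trans ?_
        rw [abs_mul, abs_neg, abs_div, abs_of_nonneg (Real.sqrt_nonneg (1 - x ^ 2))]
        gcongr
      gcongr
      · exact h0 _
      · exact h1 _)
    ((((gaussTwo_int_fst.abs).add ((gaussTwo_int_snd.abs).const_mul _)).const_mul k
      |>.const_mul C).const_mul C)
    (Filter.Eventually.of_forall fun p x hx => by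
      refine HasDerivAt.const_mul _ ?_
      refine (hd1 _).comp x ?_
      refine HasDerivAt.const_mul _ ?_
      refine HasDerivAt.congr_deriv (((hasDerivAt_id x).mul_const p.1).add ((hsder x hx).mul_const p.2)) ?_
      simp)
  refine main.2.congr_deriv ?_
  have hs : 0 < √(1 - c ^ 2) := Real.sqrt_pos.2 (by linarith [hpos c hcr])
  clear main hsder
  generalize √(1 - c ^ 2) = s at *
  have s1 := gaussTwo_stein_fst (fun p => φ (k * p.1) * φ' (k * (c * p.1 + s * p.2)))
    (fun p => k * (φ' (k * p.1) * φ' (k * (c * p.1 + s * p.2))) +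
      (k * c) * (φ (k * p.1) * φ'' (k * (c * p.1 + s * p.2))))
    (by fun_prop) (by fun_prop) (C * C) (|k| * (C * C) + |k * c| * (C * C))
    (fun p => hmulb _ _ (h0 _) (h1 _))
    (fun p => by
      refine (abs_add_le _ _).trans ?_
      rw [abs_mul k, abs_mul (k * c)]
      have := hmulb _ _ (h1 (k * p.1)) (h1 (k * (c * p.1 + s * p.2)))
      have := hmulb _ _ (h0 (k * p.1)) (h2 (k * (c * p.1 + s * p.2)))
      gcongr)
    (fun x y => by
      have e1 : HasDerivAt (fun t : ℝ => k * t) k x := by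
        simpa using (hasDerivAt_id x).const_mul k
      have e2 : HasDerivAt (fun t : ℝ => k * (c * t + s * y)) (k * c) x := by
        simpa using (((hasDerivAt_id x).const_mul c).add_const (s * y)).const_mul k
      refine HasDerivAt.congr_deriv (((hd1 _).comp x e1).mul ((hd2 _).comp x e2)) ?_
      simp only [Function.comp]
      ring)
  have s2 := gaussTwo_stein_snd (fun p => φ (k * p.1) * φ' (k * (c * p.1 + s * p.2)))
    (fun p => (k * s) * (φ (k * p.1) * φ'' (k * (c * p.1 + s * p.2))))
    (by fun_prop) (by fun_prop) (C * C) (|k * s| * (C * C))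
    (fun p => hmulb _ _ (h0 _) (h1 _))
    (fun p => by
      rw [abs_mul (k * s)]
      have := hmulb _ _ (h0 (k * p.1)) (h2 (k * (c * p.1 + s * p.2)))
      gcongr)
    (fun x y => by
      have e2 : HasDerivAt (fun t : ℝ => k * (c * x + s * t)) (k * s) y := by
        simpa using (((hasDerivAt_id y).const_mul s).const_add (c * x)).const_mul k
      refine HasDerivAt.congr_deriv (((hd2 _).comp y e2).const_mul (φ (k * x))) ?_
      ring)
  have i0 : Integrable (fun p : ℝ × ℝ => φ' (k * p.1) * φ' (k * (c * p.1 + s * p.2))) gaussTwo :=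
    gaussTwo_int_bdd _ (by fun_prop) (C * C) fun p => hmulb _ _ (h1 _) (h1 _)
  have i1 : Integrable (fun p : ℝ × ℝ => φ (k * p.1) * φ'' (k * (c * p.1 + s * p.2))) gaussTwo :=
    gaussTwo_int_bdd _ (by fun_prop) (C * C) fun p => hmulb _ _ (h0 _) (h2 _)
  have j1 : Integrable (fun p : ℝ × ℝ => p.1 * (φ (k * p.1) * φ' (k * (c * p.1 + s * p.2))))
      gaussTwo :=
    gaussTwo_int_fst.mul_bdd (c := C * C) (by apply Continuous.aestronglyMeasurable; fun_prop)
      (Filter.Eventually.of_forall fun p => hmulb _ _ (h0 _) (h1 _))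
  have j2 : Integrable (fun p : ℝ × ℝ => p.2 * (φ (k * p.1) * φ' (k * (c * p.1 + s * p.2))))
      gaussTwo :=
    gaussTwo_int_snd.mul_bdd (c := C * C) (by apply Continuous.aestronglyMeasurable; fun_prop)
      (Filter.Eventually.of_forall fun p => hmulb _ _ (h0 _) (h1 _))
  rw [integral_add (i0.const_mul _) (i1.const_mul _), integral_const_mul, integral_const_mul] at s1
  rw [integral_const_mul] at s2
  have split : ∫ p : ℝ × ℝ, φ (k * p.1) * (φ' (k * (c * p.1 + s * p.2)) *
      (k * (p.1 + -(c / s) * p.2))) ∂gaussTwo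
      = k * ∫ p : ℝ × ℝ, p.1 * (φ (k * p.1) * φ' (k * (c * p.1 + s * p.2))) ∂gaussTwo
        - k * (c / s) * ∫ p : ℝ × ℝ, p.2 * (φ (k * p.1) * φ' (k * (c * p.1 + s * p.2)))
          ∂gaussTwo := by
    rw [← integral_const_mul, ← integral_const_mul, ← integral_sub (j1.const_mul _) (j2.const_mul _)]
    congr 1
    ext p
    ring
  rw [split, s1, s2]
  change _ = k ^ 2 * ∫ p : ℝ × ℝ, φ' (k * p.1) * φ' (k * (c * p.1 + s * p.2)) ∂gaussTwo
  generalize ∫ p : ℝ × ℝ, φ' (k * p.1) * φ' (k * (c * p.1 + s * p.2)) ∂gaussTwo = A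
  generalize ∫ p : ℝ × ℝ, φ (k * p.1) * φ'' (k * (c * p.1 + s * p.2)) ∂gaussTwo = B
  field_simp
  ring
end
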